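/- Let r ≤ n and k ≤ r be natural numbers and σ : Fin r → ℝ with σ i ≠ 0 for every i with (i : ℕ) < k. Let U ∈ ℝ^{r×r} satisfy Uᵀ · U = 1, let V ∈ ℝ^{n×n} satisfy Vᵀ · V = 1, and let Σ_k ∈ ℝ^{r×n} be the truncated rectangular diagonal matrix with (Σ_k) i j = σ i if (i : ℕ) = (j : ℕ) and (i : ℕ) < k, and 0 otherwise. Define the rank-k truncation Ã = U · Σ_k · Vᵀ ∈ ℝ^{r×n}, and let U_k ∈ ℝ^{r×k} be the submatrix of the first k columns of U (i.e., U_k = U.submatrix id (Fin.castLE h) where h : k ≤ r). Then the column space of Ã equals the column space of U_k: LinearMap.range (mulVecLin Ã) = LinearMap.range (mulVecLin U_k). -/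

import Mathlib

open Matrix

theorem Matrix.range_mulVecLin_mul_le {R l m n : Type*} [CommSemiring R] [Fintype m] [Fintype n]
    (A : Matrix l m R) (B : Matrix m n R) :
    LinearMap.range (A * B).mulVecLin ≤ LinearMap.range A.mulVecLin := by
  rw [Matrix.mulVecLin_mul]
  exact LinearMap.range_comp_le_range _ _

/-- Column space of the rank-`k` SVD truncation: with `Uᵀ U = 1`, `Vᵀ V = 1`,
`Σ_k` the truncated rectangular diagonal matrix of the (nonzero) top-`k`
singular values, and `Ã = U Σ_k Vᵀ`, the column space of `Ã` equals the
column space of the first `k` columns of `U`. -/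
theorem column_space_truncated_svd
    {r n k : ℕ} (hrn : r ≤ n) (hk : k ≤ r) (σ : Fin r → ℝ)
    (hσ : ∀ i : Fin r, (i : ℕ) < k → σ i ≠ 0)
    (U : Matrix (Fin r) (Fin r) ℝ) (hU : Uᵀ * U = 1)
    (V : Matrix (Fin n) (Fin n) ℝ) (hV : Vᵀ * V = 1)
    (Sk : Matrix (Fin r) (Fin n) ℝ)
    (hSk : ∀ i j, Sk i j = if (i : ℕ) = (j : ℕ) ∧ (i : ℕ) < k then σ i else 0) :
    LinearMap.range (U * Sk * Vᵀ).mulVecLin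
      = LinearMap.range (U.submatrix id (Fin.castLE hk)).mulVecLin := by
  set E : Matrix (Fin r) (Fin k) ℝ := (1 : Matrix (Fin r) (Fin r) ℝ).submatrix id (Fin.castLE hk)
    with hE
  have hUE : U.submatrix id (Fin.castLE hk) = U * E := by
    ext i j
    simp [hE, Matrix.mul_apply, Matrix.one_apply]
  have hED : Sk = E * Sk.submatrix (Fin.castLE hk) id := by
    ext i j
    rw [Matrix.mul_apply]
    by_cases hi : (i : ℕ) < k
    · rw [Finset.sum_eq_single ⟨i, hi⟩]
      · simp [hE, Matrix.one_apply]
      · intro b _ hb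
        have : i ≠ Fin.castLE hk b := fun h => hb (Fin.ext (by simp [h]))
        simp [hE, this]
      · simp
    · rw [hSk, if_neg (by tauto), Finset.sum_eq_zero]
      intro b _
      have : i ≠ Fin.castLE hk b := fun h => hi (by simp [h])
      simp [hE, this]
  obtain ⟨G, hG⟩ : ∃ G : Matrix (Fin n) (Fin k) ℝ, E = Sk * G := by
    refine ⟨Matrix.of fun j l => if j = Fin.castLE (hk.trans hrn) l then
      (σ (Fin.castLE hk l))⁻¹ else 0, ?_⟩
    ext i l
    simp only [hE, Matrix.mul_apply, Matrix.of_apply, mul_ite, mul_zero, Finset.sum_ite_eq',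
      Finset.mem_univ, if_true, hSk, Matrix.submatrix_apply, id,
      Matrix.one_apply, Fin.val_castLE]
    by_cases h : i = Fin.castLE hk l
    · subst h
      simp [mul_inv_cancel₀ (hσ (Fin.castLE hk l) l.isLt)]
    · have h' : (i : ℕ) ≠ l := fun e => h (Fin.ext e)
      simp [h, h']
  rw [hUE]
  apply le_antisymm
  · have h : U * Sk * Vᵀ = U * E * (Sk.submatrix (Fin.castLE hk) id * Vᵀ) := by
      conv_lhs => rw [hED]
      simp only [Matrix.mul_assoc]
    rw [h]
    exact Matrix.range_mulVecLin_mul_le _ _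
  · have h : U * E = U * Sk * Vᵀ * (V * G) := by
      rw [Matrix.mul_assoc (U * Sk), ← Matrix.mul_assoc Vᵀ, hV, Matrix.one_mul,
        Matrix.mul_assoc, ← hG]
    rw [h]
    exact Matrix.range_mulVecLin_mul_le _ _
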